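/- Under the AOD algorithm with horizon T (losses valued in [0,1], convex, G-Lipschitz gradients, domain diameter at most D), for every interval J = [i,j] in the dense geometric covering collection D with j ≤ T, Σ_{t=i}^{j} f_t(w_t) − min_{w∈Ω} Σ_{t=i}^{j} f_t(w) ≤ ( √(3·c(j)) + DG )·√(j−i+1), where c(j) = 1 + ln j + ln(1 + log₂ T) + ln( (5 + 3 ln(1+j))/2 ). -/

import Mathlib

/-- The AdaNormalHedge potential `Φ(R,C) = exp([R]₊²/(3C))` (with `Φ(R,0) = 1`,
matching `Φ(0,0) = 1`, since `x/0 = 0` in Lean). -/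
noncomputable def anhPot (R C : ℝ) : ℝ := Real.exp (max R 0 ^ 2 / (3 * C))

/-- The AdaNormalHedge weight function `w(R,C) = (Φ(R+1,C+1) − Φ(R−1,C+1))/2`. -/
noncomputable def anhW (R C : ℝ) : ℝ := (anhPot (R + 1) (C + 1) - anhPot (R - 1) (C + 1)) / 2

/-- The starting round `(i−1)·2^k + 1` of the interval of the dense geometric covering
level `D_k` that contains round `t ≥ 1`. -/
def dgcStart (k t : ℕ) : ℕ := (t - 1) / 2 ^ k * 2 ^ k + 1

/-- The levels `k` with `2^k ≤ T` of the dense geometric covering collection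
`D = ∪_{k ≥ 0, 2^k ≤ T} D_k`, `D_k = {[(i−1)·2^k + 1, i·2^k] : i ≥ 1}`.  At every round
exactly one interval of each level is active, so experts are indexed by levels. -/
def dgcLevels (T : ℕ) : Finset ℕ := (Finset.range (T + 1)).filter fun k => 2 ^ k ≤ T

/-- `R_{t−1,I} = Σ_{u=min I}^{t−1} (f_u(w_u) − f_u(w_{u,I}))` for the active level-`k`
expert at round `t` (whose interval starts at `dgcStart k t`); `x k u` is the action of
the level-`k` expert at round `u`. -/
noncomputable def aodMetaR {α : Type*} (f : ℕ → α → ℝ) (w : ℕ → α) (x : ℕ → ℕ → α)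
    (k t : ℕ) : ℝ :=
  ∑ u ∈ Finset.Icc (dgcStart k t) (t - 1), (f u (w u) - f u (x k u))

/-- `C_{t−1,I} = Σ_{u=min I}^{t−1} |f_u(w_u) − f_u(w_{u,I})|` for the active level-`k`
expert at round `t`. -/
noncomputable def aodMetaC {α : Type*} (f : ℕ → α → ℝ) (w : ℕ → α) (x : ℕ → ℕ → α)
    (k t : ℕ) : ℝ :=
  ∑ u ∈ Finset.Icc (dgcStart k t) (t - 1), |f u (w u) - f u (x k u)|

/-- The AdaNormalHedge weight `p_{t,I}` that AOD assigns to the active level-`k`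
expert at round `t`. -/
noncomputable def aodWeight {α : Type*} (T : ℕ) (f : ℕ → α → ℝ) (w : ℕ → α)
    (x : ℕ → ℕ → α) (k t : ℕ) : ℝ :=
  anhW (aodMetaR f w x k t) (aodMetaC f w x k t) /
    ∑ k' ∈ dgcLevels T, anhW (aodMetaR f w x k' t) (aodMetaC f w x k' t)

/-- `c(t) = 1 + ln t + ln(1 + log₂ T) + ln((5 + 3 ln(1+t))/2)`. -/
noncomputable def cAOD (T t : ℕ) : ℝ :=
  1 + Real.log t + Real.log (1 + Real.logb 2 T) + Real.log ((5 + 3 * Real.log (1 + (t : ℝ))) / 2)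

/-- The tangent-line bound for the perspective `a² / b` of the square. -/
lemma two_mul_sub_sq_mul_le_sq_div {a b : ℝ} (l : ℝ) (hb : 0 ≤ b) (h : b = 0 → a = 0) :
    2 * l * a - l ^ 2 * b ≤ a ^ 2 / b := by
  rcases hb.eq_or_lt with hb | hb
  · simp [h hb.symm, ← hb]
  · rw [le_div_iff₀ hb]
    nlinarith [sq_nonneg (a - l * b)]

lemma anhPot_nonneg (R C : ℝ) : 0 ≤ anhPot R C := (Real.exp_pos _).le

lemma one_le_anhPot (R : ℝ) {C : ℝ} (hC : 0 ≤ C) : 1 ≤ anhPot R C :=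
  Real.one_le_exp (by positivity)

lemma anhPot_mono {R R' C : ℝ} (hC : 0 ≤ C) (h : R ≤ R') : anhPot R C ≤ anhPot R' C := by
  unfold anhPot
  gcongr

lemma anhW_nonneg (R : ℝ) {C : ℝ} (hC : 0 ≤ C) : 0 ≤ anhW R C := by
  have := anhPot_mono (C := C + 1) (by linarith) (show R - 1 ≤ R + 1 by linarith)
  unfold anhW
  linarith

lemma anhW_zero_zero_pos : 0 < anhW 0 0 := by
  simp [anhW, anhPot]

lemma exp_five_thirds_le_six : Real.exp (5 / 3) ≤ 6 := by
  have h : Real.exp (5 / 3) ^ 3 = Real.exp 1 ^ 5 := by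
    rw [← Real.exp_nat_mul, ← Real.exp_nat_mul]
    norm_num
  have h1 : Real.exp 1 ^ 5 ≤ 2.72 ^ 5 :=
    pow_le_pow_left₀ (Real.exp_pos 1).le (by linarith [Real.exp_one_lt_d9]) 5
  refine le_of_pow_le_pow_left₀ (n := 3) (by norm_num) (by norm_num) ?_
  rw [h]
  exact h1.trans (by norm_num)

lemma anhPot_midpoint_le {R C : ℝ} (h : |R| ≤ C) :
    (anhPot (R + 1) (C + 1) + anhPot (R - 1) (C + 1)) / 2 ≤ anhPot R C + 5 := by
  have hC : 0 ≤ C := (abs_nonneg R).trans h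
  have h1 := one_le_anhPot R hC
  have h6 := exp_five_thirds_le_six
  rcases lt_or_ge R 0 with hR | hR
  · have hle : anhPot (R + 1) (C + 1) ≤ Real.exp (5 / 3) := by
      have h0 : 0 ≤ max (R + 1) 0 := le_max_right _ _
      have h2 : max (R + 1) 0 ≤ 1 := max_le (by linarith) zero_le_one
      refine Real.exp_le_exp.2 ?_
      rw [div_le_iff₀ (by linarith)]
      nlinarith
    have := anhPot_mono (C := C + 1) (by linarith) (show R - 1 ≤ R + 1 by linarith)
    linarith
  · have hRC : R ≤ C := (le_abs_self R).trans h
    have hplus : anhPot (R + 1) (C + 1) = Real.exp ((R + 1) ^ 2 / (3 * (C + 1))) := by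
      rw [anhPot, max_eq_left (by linarith)]
    have hminus : anhPot (R - 1) (C + 1) ≤ Real.exp ((R - 1) ^ 2 / (3 * (C + 1))) := by
      refine Real.exp_le_exp.2 (div_le_div_of_nonneg_right ?_ (by linarith))
      rcases le_total (R - 1) 0 with h0 | h0
      · simpa [max_eq_right h0] using sq_nonneg (R - 1)
      · rw [max_eq_left h0]
    set M := 3 * (C + 1) with hM
    have hM0 : 0 < M := by linarith
    have hcosh : (Real.exp ((R + 1) ^ 2 / M) + Real.exp ((R - 1) ^ 2 / M)) / 2
        ≤ Real.exp ((R ^ 2 + 1) / M + (2 * R / M) ^ 2 / 2) := by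
      have e1 : (R + 1) ^ 2 / M = (R ^ 2 + 1) / M + 2 * R / M := by ring
      have e2 : (R - 1) ^ 2 / M = (R ^ 2 + 1) / M + -(2 * R / M) := by ring
      rw [e1, e2, Real.exp_add, Real.exp_add, Real.exp_add, ← mul_add, mul_div_assoc,
        ← Real.cosh_eq]
      gcongr
      exact Real.cosh_le_exp_half_sq _
    rcases lt_or_ge (R ^ 2) M with hlt | hge
    · have hE : (R ^ 2 + 1) / M + (2 * R / M) ^ 2 / 2 ≤ 5 / 3 := by
        have a1 : R ^ 2 / M ≤ 1 := (div_le_one hM0).2 hlt.le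
        have a2 : 1 / M ≤ 1 / 3 := one_div_le_one_div_of_le (by norm_num) (by linarith)
        have a3 : R / M ≤ 1 / 3 := by rw [div_le_iff₀ hM0]; linarith
        have a4 : 0 ≤ R / M := by positivity
        have e : (R ^ 2 + 1) / M + (2 * R / M) ^ 2 / 2
            = R ^ 2 / M + 1 / M + 2 * (R / M) ^ 2 := by ring
        rw [e]
        nlinarith
      have := Real.exp_le_exp.2 hE
      linarith
    · have hCpos : 0 < C := by
        rcases hC.eq_or_lt with h0 | h0
        · have : R = 0 := by linarith
          rw [this] at hge
          linarith
        · exact h0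
      have hE : (R ^ 2 + 1) / M + (2 * R / M) ^ 2 / 2 ≤ max R 0 ^ 2 / (3 * C) := by
        rw [max_eq_left hR, ← sub_nonneg]
        have e : R ^ 2 / (3 * C) - ((R ^ 2 + 1) / M + (2 * R / M) ^ 2 / 2)
            = (R ^ 2 * (C + 3) - 3 * C * (C + 1)) / (9 * C * (C + 1) ^ 2) := by
          rw [hM]
          field_simp
          ring
        rw [e]
        apply div_nonneg _ (by positivity)
        nlinarith
      have := Real.exp_le_exp.2 hE
      rw [← anhPot] at this
      linarith

/-- Joint convexity of the potential along the segment from `(R, C)` to `(R + e, C + 1)`. -/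
lemma anhPot_segment_le {R C s : ℝ} (e : ℝ) (h : |R| ≤ C) (hs0 : 0 ≤ s) (hs1 : s ≤ 1) :
    anhPot (R + s * e) (C + s) ≤ (1 - s) * anhPot R C + s * anhPot (R + e) (C + 1) := by
  have hC : 0 ≤ C := (abs_nonneg R).trans h
  set a := max R 0 with ha
  set b := max (R + e) 0 with hb
  have ha0 : 0 ≤ a := le_max_right _ _
  have hb0 : 0 ≤ b := le_max_right _ _
  have hmax : max (R + s * e) 0 ≤ (1 - s) * a + s * b := by
    refine max_le ?_ (by nlinarith)
    have h1 : R ≤ a := le_max_left _ _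
    have h2 : R + e ≤ b := le_max_left _ _
    nlinarith
  have hquad : max (R + s * e) 0 ^ 2 / (3 * (C + s))
      ≤ (1 - s) * (a ^ 2 / (3 * C)) + s * (b ^ 2 / (3 * (C + 1))) := by
    set l := ((1 - s) * a + s * b) / (3 * (C + s)) with hl
    have t1 := two_mul_sub_sq_mul_le_sq_div (a := a) (b := 3 * C) l (by linarith) (by
      intro h0
      have hC0 : C = 0 := by linarith
      rw [hC0] at h
      simp [ha, abs_nonpos_iff.1 h])
    have t2 := two_mul_sub_sq_mul_le_sq_div (a := b) (b := 3 * (C + 1)) l (by linarith)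
      (fun h0 => by linarith)
    have t3 : max (R + s * e) 0 ^ 2 / (3 * (C + s)) ≤ ((1 - s) * a + s * b) ^ 2 / (3 * (C + s)) := by
      gcongr
    have t4 : ((1 - s) * a + s * b) ^ 2 / (3 * (C + s))
        = 2 * l * ((1 - s) * a + s * b) - l ^ 2 * (3 * (C + s)) := by
      rcases eq_or_ne (C + s) 0 with h0 | h0
      · simp [hl, h0]
      · rw [hl]
        field_simp
        ring
    nlinarith [mul_le_mul_of_nonneg_left t1 (sub_nonneg.2 hs1), mul_le_mul_of_nonneg_left t2 hs0]
  calc anhPot (R + s * e) (C + s)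
      ≤ Real.exp ((1 - s) * (a ^ 2 / (3 * C)) + s * (b ^ 2 / (3 * (C + 1)))) :=
        Real.exp_le_exp.2 hquad
    _ ≤ (1 - s) * anhPot R C + s * anhPot (R + e) (C + 1) :=
        convexOn_exp.2 (Set.mem_univ _) (Set.mem_univ _) (sub_nonneg.2 hs1) hs0 (by ring)

lemma anhPot_step_le {R C r : ℝ} (h : |R| ≤ C) (hr : |r| ≤ 1) :
    anhPot (R + r) (C + |r|) ≤ anhPot R C + anhW R C * r + 5 := by
  have hmid := anhPot_midpoint_le h
  have hs := abs_nonneg r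
  rcases le_total 0 r with h0 | h0
  · have hseg := anhPot_segment_le 1 h hs hr
    rw [abs_of_nonneg h0] at hseg hr ⊢
    rw [mul_one] at hseg
    unfold anhW
    nlinarith [mul_le_mul_of_nonneg_left hmid h0]
  · have hseg := anhPot_segment_le (-1) h hs hr
    rw [abs_of_nonpos h0] at hseg hr ⊢
    rw [show R + -r * -1 = R + r by ring, ← sub_eq_add_neg R 1] at hseg
    unfold anhW
    nlinarith [mul_le_mul_of_nonneg_left hmid (neg_nonneg.2 h0)]

lemma norm_sub_le_of_forall_norm_sub_le {E : Type*} [NormedAddCommGroup E] [InnerProductSpace ℝ E]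
    {K : Set E} (hK : Convex ℝ K) {z u v : E} (hu : u ∈ K)
    (hmin : ∀ z' ∈ K, ‖u - z‖ ≤ ‖z' - z‖) (hv : v ∈ K) : ‖u - v‖ ≤ ‖z - v‖ := by
  have : Nonempty K := ⟨⟨u, hu⟩⟩
  have hinf : ‖z - u‖ = ⨅ y : K, ‖z - y‖ := by
    refine le_antisymm (le_ciInf fun y => ?_)
      (ciInf_le ⟨0, by rintro _ ⟨y, rfl⟩; exact norm_nonneg _⟩ (⟨u, hu⟩ : K))
    rw [norm_sub_rev z u, norm_sub_rev z y]
    exact hmin y y.2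
  have hin := (norm_eq_iInf_iff_real_inner_le_zero hK hu).1 hinf v hv
  have hexp : ‖z - v‖ ^ 2 = ‖z - u‖ ^ 2 - 2 * inner ℝ (z - u) (v - u) + ‖u - v‖ ^ 2 := by
    rw [show z - v = (z - u) - (v - u) by abel, norm_sub_sq_real, norm_sub_rev u v]
  refine le_of_sq_le_sq ?_ (norm_nonneg _)
  nlinarith [sq_nonneg ‖z - u‖]

lemma ConvexOn.sub_le_inner_gradient {E : Type*} [NormedAddCommGroup E] [InnerProductSpace ℝ E]
    [CompleteSpace E] {f : E → ℝ} (hf : ConvexOn ℝ Set.univ f) {x : E}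
    (hd : DifferentiableAt ℝ f x) (v : E) : f x - f v ≤ inner ℝ (gradient f x) (x - v) := by
  have hg : ConvexOn ℝ Set.univ (f ∘ AffineMap.lineMap (k := ℝ) x v) := by
    simpa using hf.comp_affineMap (AffineMap.lineMap (k := ℝ) x v)
  have hder : HasDerivAt (f ∘ AffineMap.lineMap (k := ℝ) x v) (inner ℝ (gradient f x) (v - x)) 0 := by
    have h1 : HasFDerivAt f (InnerProductSpace.toDual ℝ E (gradient f x))
        (AffineMap.lineMap (k := ℝ) x v (0 : ℝ)) := by
      simpa using hd.hasGradientAt.hasFDerivAt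
    simpa using h1.comp_hasDerivAt (0 : ℝ) (AffineMap.hasDerivAt_lineMap (a := x) (b := v))
  have := hg.le_slope_of_hasDerivAt (Set.mem_univ _) (Set.mem_univ _) zero_lt_one hder
  simp only [slope_def_field, Function.comp_apply, AffineMap.lineMap_apply_one,
    AffineMap.lineMap_apply_zero, sub_zero, div_one] at this
  rw [← neg_sub v x, inner_neg_right]
  linarith

lemma dgcStart_le {k t : ℕ} (ht : 1 ≤ t) : dgcStart k t ≤ t := by
  have := Nat.div_mul_le_self (t - 1) (2 ^ k)
  unfold dgcStart
  omega

lemma dgcStart_zero_left {t : ℕ} (ht : 1 ≤ t) : dgcStart 0 t = t := by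
  simp [dgcStart, Nat.sub_add_cancel ht]

lemma dgcStart_succ (k t : ℕ) : dgcStart k (t + 1) = t + 1 ∨ dgcStart k (t + 1) = dgcStart k t := by
  unfold dgcStart
  by_cases h : 2 ^ k ∣ t
  · left
    rw [Nat.add_sub_cancel, Nat.div_mul_cancel h]
  · right
    cases t with
    | zero => simp at h
    | succ s => simp [Nat.succ_div_of_not_dvd h]

lemma dgcStart_mul (k : ℕ) {i : ℕ} (hi : 1 ≤ i) : dgcStart k (i * 2 ^ k) = (i - 1) * 2 ^ k + 1 := by
  have hp : 0 < 2 ^ k := by positivity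
  obtain ⟨m, rfl⟩ := Nat.exists_eq_add_of_le' hi
  have : (m + 1) * 2 ^ k - 1 = (2 ^ k - 1) + m * 2 ^ k := by
    rw [add_mul, one_mul]
    omega
  rw [dgcStart, this, Nat.add_mul_div_right _ _ hp, Nat.div_eq_of_lt (by omega), zero_add,
    Nat.add_sub_cancel]

lemma zero_mem_dgcLevels {T : ℕ} (hT : 1 ≤ T) : 0 ∈ dgcLevels T := by
  simp [dgcLevels, hT]

lemma card_dgcLevels_le (T : ℕ) : ((dgcLevels T).card : ℝ) ≤ 1 + Real.logb 2 T := by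
  have hsub : dgcLevels T ⊆ Finset.range (Nat.log 2 T + 1) := fun k hk => by
    rw [dgcLevels, Finset.mem_filter] at hk
    exact Finset.mem_range.2 (Nat.lt_succ_of_le (Nat.le_log_of_pow_le one_lt_two hk.2))
  have hcard : ((dgcLevels T).card : ℝ) ≤ (Nat.log 2 T + 1 : ℕ) := by
    exact_mod_cast (Finset.card_le_card hsub).trans_eq (Finset.card_range _)
  have := Real.natLog_le_logb T 2
  push_cast at hcard this
  linarith

/-- Growth of the total potential of the active intervals when the instantaneous regrets `q k u`
have nonpositive weighted sum in every round. -/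
lemma sum_anhPot_le (S : Finset ℕ) (q : ℕ → ℕ → ℝ)
    (hq : ∀ k ∈ S, ∀ u, 1 ≤ u → |q k u| ≤ 1)
    (hw : ∀ t, 1 ≤ t → ∑ k ∈ S, anhW (∑ u ∈ Finset.Icc (dgcStart k t) (t - 1), q k u)
      (∑ u ∈ Finset.Icc (dgcStart k t) (t - 1), |q k u|) * q k t ≤ 0) (t : ℕ) :
    ∑ k ∈ S, anhPot (∑ u ∈ Finset.Icc (dgcStart k t) t, q k u)
      (∑ u ∈ Finset.Icc (dgcStart k t) t, |q k u|) ≤ S.card * (1 + 5 * t) := by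
  induction t with
  | zero => simp [dgcStart, anhPot]
  | succ t ih =>
    have hstep : ∀ k ∈ S, anhPot (∑ u ∈ Finset.Icc (dgcStart k (t + 1)) (t + 1), q k u)
        (∑ u ∈ Finset.Icc (dgcStart k (t + 1)) (t + 1), |q k u|)
        ≤ anhPot (∑ u ∈ Finset.Icc (dgcStart k t) t, q k u)
            (∑ u ∈ Finset.Icc (dgcStart k t) t, |q k u|)
          + anhW (∑ u ∈ Finset.Icc (dgcStart k (t + 1)) (t + 1 - 1), q k u)
              (∑ u ∈ Finset.Icc (dgcStart k (t + 1)) (t + 1 - 1), |q k u|) * q k (t + 1)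
          + 5 := fun k hk => by
      have hle : dgcStart k (t + 1) ≤ t + 1 := dgcStart_le (by omega)
      rw [Finset.sum_Icc_succ_top hle, Finset.sum_Icc_succ_top hle, Nat.add_sub_cancel]
      refine (anhPot_step_le (Finset.abs_sum_le_sum_abs _ _) (hq k hk _ (by omega))).trans ?_
      gcongr ?_ + _ + _
      rcases dgcStart_succ k t with h | h
      · rw [h, Finset.Icc_eq_empty (by omega), Finset.sum_empty, Finset.sum_empty]
        refine le_trans ?_ (one_le_anhPot _ (Finset.sum_nonneg fun _ _ => abs_nonneg _))
        simp [anhPot]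
      · rw [h]
    have hsum := Finset.sum_le_sum hstep
    rw [Finset.sum_add_distrib, Finset.sum_add_distrib, Finset.sum_const, nsmul_eq_mul] at hsum
    have := hw (t + 1) (by omega)
    push_cast
    linarith

lemma le_sqrt_mul_of_anhPot_le {R C b : ℝ} (h : |R| ≤ C) (hb : anhPot R C ≤ Real.exp b) :
    R ≤ Real.sqrt (3 * b * C) := by
  have hC : 0 ≤ C := (abs_nonneg R).trans h
  refine (le_max_left R 0).trans (Real.le_sqrt_of_sq_le ?_)
  rcases hC.eq_or_lt with h0 | h0
  · rw [← h0] at h ⊢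
    simp [abs_nonpos_iff.1 h]
  · have := Real.exp_le_exp.1 hb
    rw [div_le_iff₀ (by linarith)] at this
    linarith

lemma cAOD_nonneg_and_card_mul_le_exp {T t : ℕ} (hT : 1 ≤ T) (ht : 1 ≤ t) :
    0 ≤ cAOD T t ∧ (dgcLevels T).card * (1 + 5 * (t : ℝ)) ≤ Real.exp (cAOD T t) := by
  have hT' : (1 : ℝ) ≤ T := by exact_mod_cast hT
  have ht' : (1 : ℝ) ≤ t := by exact_mod_cast ht
  have hlog : 0 ≤ Real.logb 2 T := Real.logb_nonneg one_lt_two hT'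
  have hlog1 : 0 ≤ Real.log (1 + (t : ℝ)) := Real.log_nonneg (by linarith)
  have hcard := card_dgcLevels_le T
  constructor
  · have h1 := Real.log_nonneg ht'
    have h2 := Real.log_nonneg (show 1 ≤ 1 + Real.logb 2 T by linarith)
    have h3 := Real.log_nonneg (show 1 ≤ (5 + 3 * Real.log (1 + (t : ℝ))) / 2 by linarith)
    unfold cAOD
    linarith
  · rw [cAOD, Real.exp_add, Real.exp_add, Real.exp_add, Real.exp_log (by linarith),
      Real.exp_log (by linarith), Real.exp_log (by linarith)]
    have he : 6 ≤ Real.exp 1 * ((5 + 3 * Real.log (1 + (t : ℝ))) / 2) := by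
      nlinarith [Real.exp_one_gt_d9]
    calc (dgcLevels T).card * (1 + 5 * (t : ℝ)) ≤ (1 + Real.logb 2 T) * (6 * t) := by
          gcongr
          linarith
      _ = t * (1 + Real.logb 2 T) * 6 := by ring
      _ ≤ t * (1 + Real.logb 2 T) * (Real.exp 1 * ((5 + 3 * Real.log (1 + (t : ℝ))) / 2)) := by
          gcongr
      _ = _ := by ring

/-- Regret of projected online gradient descent with the step size `D / (G √n)` over `n` rounds. -/
lemma sum_inner_le_of_projected_gradient {E : Type*} [NormedAddCommGroup E]
    [InnerProductSpace ℝ E] {Ω : Set E} (hconv : Convex ℝ Ω) {D G : ℝ}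
    (hdiam : ∀ z ∈ Ω, ∀ z' ∈ Ω, ‖z - z'‖ ≤ D) {proj : E → E}
    (hproj : ∀ z, proj z ∈ Ω ∧ ∀ z' ∈ Ω, ‖proj z - z‖ ≤ ‖z' - z‖)
    (n : ℕ) (x g : ℕ → E) (hx : ∀ t, x t ∈ Ω) (hg : ∀ t, ‖g t‖ ≤ G)
    (hup : ∀ t, x (t + 1) = proj (x t - (D / (G * Real.sqrt n)) • g t)) {v : E} (hv : v ∈ Ω) :
    ∑ t ∈ Finset.range n, inner ℝ (g t) (x t - v) ≤ D * G * Real.sqrt n := by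
  have hD0 : 0 ≤ D := (norm_nonneg _).trans (hdiam v hv v hv)
  have hG0 : 0 ≤ G := (norm_nonneg _).trans (hg 0)
  rcases (mul_nonneg hD0 hG0).eq_or_lt with h0 | h0
  · rw [← h0, zero_mul]
    refine Finset.sum_nonpos fun t _ => (real_inner_le_norm _ _).trans ?_
    rw [h0, mul_comm D]
    exact mul_le_mul (hg t) (hdiam _ (hx t) v hv) (norm_nonneg _) hG0
  rcases n.eq_zero_or_pos with rfl | hn
  · simp
  have hD : 0 < D := pos_of_mul_pos_left h0 hG0
  have hG : 0 < G := pos_of_mul_pos_right h0 hD0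
  have hn' : (0 : ℝ) < n := by exact_mod_cast hn
  have hs : 0 < Real.sqrt n := Real.sqrt_pos.2 hn'
  set η := D / (G * Real.sqrt n) with hη
  have hη0 : 0 < η := by positivity
  have hstep : ∀ t, 2 * η * inner ℝ (g t) (x t - v)
      ≤ (‖x t - v‖ ^ 2 - ‖x (t + 1) - v‖ ^ 2) + η ^ 2 * G ^ 2 := fun t => by
    have h1 : ‖x (t + 1) - v‖ ≤ ‖(x t - v) - η • g t‖ := by
      rw [hup t, sub_right_comm]
      exact norm_sub_le_of_forall_norm_sub_le hconv (hproj _).1 (hproj _).2 hv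
    have h2 : ‖x (t + 1) - v‖ ^ 2 ≤ ‖(x t - v) - η • g t‖ ^ 2 := by gcongr
    rw [norm_sub_sq_real (x t - v), inner_smul_right, norm_smul, Real.norm_of_nonneg hη0.le, mul_pow,
      real_inner_comm] at h2
    have h3 : η ^ 2 * ‖g t‖ ^ 2 ≤ η ^ 2 * G ^ 2 := by
      gcongr
      exact hg t
    linarith
  have hsum := Finset.sum_le_sum fun t (_ : t ∈ Finset.range n) => hstep t
  rw [← Finset.mul_sum, Finset.sum_add_distrib, Finset.sum_range_sub', Finset.sum_const,
    Finset.card_range, nsmul_eq_mul] at hsum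
  have h0D : ‖x 0 - v‖ ^ 2 ≤ D ^ 2 := by
    gcongr
    exact hdiam _ (hx 0) v hv
  have hηG : (n : ℝ) * (η ^ 2 * G ^ 2) = D ^ 2 := by
    rw [hη, div_pow, mul_pow, Real.sq_sqrt hn'.le]
    field_simp
  have hηD : η * (D * G * Real.sqrt n) = D ^ 2 := by
    rw [hη]
    field_simp
  refine le_of_mul_le_mul_left ?_ (mul_pos two_pos hη0)
  nlinarith [sq_nonneg ‖x n - v‖]

/-- Lemma 2: under the AOD algorithm, on every interval
`J = [(i−1)·2^k + 1, i·2^k]` of the dense geometric covering collection with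
`i·2^k ≤ T`, the static regret of AOD is at most `(√(3c(max J)) + DG)·√|J|`. -/
theorem aod_interval_regret
    (d T : ℕ) (hT : 1 ≤ T) (D G : ℝ)
    (Ω : Set (EuclideanSpace ℝ (Fin d)))
    (hne : Ω.Nonempty) (hcomp : IsCompact Ω) (hconv : Convex ℝ Ω)
    (hdiam : ∀ z ∈ Ω, ∀ z' ∈ Ω, ‖z - z'‖ ≤ D)
    (f : ℕ → EuclideanSpace ℝ (Fin d) → ℝ)
    (hfconv : ∀ t, ConvexOn ℝ Set.univ (f t))
    (hfdiff : ∀ t z, DifferentiableAt ℝ (f t) z)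
    (hgrad : ∀ t, ∀ z ∈ Ω, ‖gradient (f t) z‖ ≤ G)
    (hrange : ∀ t, ∀ z ∈ Ω, 0 ≤ f t z ∧ f t z ≤ 1)
    (proj : EuclideanSpace ℝ (Fin d) → EuclideanSpace ℝ (Fin d))
    (hproj : ∀ z, proj z ∈ Ω ∧ ∀ z' ∈ Ω, ‖proj z - z‖ ≤ ‖z' - z‖)
    (x : ℕ → ℕ → EuclideanSpace ℝ (Fin d))
    (hx1 : ∀ k, x k 1 ∈ Ω)
    (hxup : ∀ k t, 1 ≤ t →
      x k (t + 1) = proj (x k t - (D / (G * Real.sqrt ((2 : ℝ) ^ k))) • gradient (f t) (x k t)))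
    (w : ℕ → EuclideanSpace ℝ (Fin d))
    (hw : ∀ t, 1 ≤ t → w t = ∑ k ∈ dgcLevels T, aodWeight T f w x k t • x k t)
    (k i : ℕ) (hk : 2 ^ k ≤ T) (hi : 1 ≤ i) (hiT : i * 2 ^ k ≤ T) :
    ∀ v ∈ Ω,
      ∑ t ∈ Finset.Icc ((i - 1) * 2 ^ k + 1) (i * 2 ^ k), f t (w t)
        - ∑ t ∈ Finset.Icc ((i - 1) * 2 ^ k + 1) (i * 2 ^ k), f t v
      ≤ (Real.sqrt (3 * cAOD T (i * 2 ^ k)) + D * G) *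
          Real.sqrt ((i * 2 ^ k - ((i - 1) * 2 ^ k + 1) + 1 : ℕ) : ℝ) := by
  intro v hv
  have hend : i * 2 ^ k = (i - 1) * 2 ^ k + 2 ^ k := by
    rw [← Nat.succ_mul, Nat.succ_eq_add_one, Nat.sub_add_cancel hi]
  have hlen : i * 2 ^ k - ((i - 1) * 2 ^ k + 1) + 1 = 2 ^ k := by
    have : 0 < 2 ^ k := by positivity
    omega
  have hj : 1 ≤ i * 2 ^ k := Nat.one_le_iff_ne_zero.2 (by positivity)
  have hxΩ : ∀ l t, 1 ≤ t → x l t ∈ Ω := by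
    intro l t ht
    obtain ⟨s, rfl⟩ := Nat.exists_eq_add_of_le' ht
    rcases s.eq_zero_or_pos with rfl | hs
    · exact hx1 l
    · rw [hxup l s hs]
      exact (hproj _).1
  have hW : ∀ l t, 0 ≤ anhW (aodMetaR f w x l t) (aodMetaC f w x l t) := fun l t =>
    anhW_nonneg _ (Finset.sum_nonneg fun _ _ => abs_nonneg _)
  have hWsum : ∀ t, 1 ≤ t →
      0 < ∑ l ∈ dgcLevels T, anhW (aodMetaR f w x l t) (aodMetaC f w x l t) := fun t ht => by
    refine Finset.sum_pos' (fun l _ => hW l t) ⟨0, zero_mem_dgcLevels hT, ?_⟩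
    rw [aodMetaR, aodMetaC, dgcStart_zero_left ht, Finset.Icc_eq_empty (by omega),
      Finset.sum_empty, Finset.sum_empty]
    exact anhW_zero_zero_pos
  have hp0 : ∀ l t, 0 ≤ aodWeight T f w x l t := fun l t =>
    div_nonneg (hW l t) (Finset.sum_nonneg fun l _ => hW l t)
  have hp1 : ∀ t, 1 ≤ t → ∑ l ∈ dgcLevels T, aodWeight T f w x l t = 1 := fun t ht => by
    simp only [aodWeight]
    rw [← Finset.sum_div, div_self (hWsum t ht).ne']
  have hwΩ : ∀ t, 1 ≤ t → w t ∈ Ω := fun t ht => by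
    rw [hw t ht]
    exact hconv.sum_mem (fun l _ => hp0 l t) (hp1 t ht) fun l _ => hxΩ l t ht
  have hq : ∀ l t, 1 ≤ t → |f t (w t) - f t (x l t)| ≤ 1 := fun l t ht => by
    have h1 := hrange t _ (hwΩ t ht)
    have h2 := hrange t _ (hxΩ l t ht)
    rw [abs_le]
    constructor <;> linarith
  have hmix : ∀ t, 1 ≤ t → ∑ l ∈ dgcLevels T,
      anhW (aodMetaR f w x l t) (aodMetaC f w x l t) * (f t (w t) - f t (x l t)) ≤ 0 :=
    fun t ht => by
    have hjen := (hfconv t).map_sum_le (fun l _ => hp0 l t) (hp1 t ht)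
      (fun l _ => Set.mem_univ (x l t))
    rw [← hw t ht] at hjen
    simp only [aodWeight, smul_eq_mul, div_mul_eq_mul_div] at hjen
    rw [← Finset.sum_div, le_div_iff₀ (hWsum t ht)] at hjen
    simp only [mul_sub]
    rw [Finset.sum_sub_distrib, ← Finset.sum_mul]
    linarith
  obtain ⟨hc0, hcexp⟩ := cAOD_nonneg_and_card_mul_le_exp hT hj
  have hpot := (sum_anhPot_le (dgcLevels T) (fun l u => f u (w u) - f u (x l u))
    (fun l _ u hu => hq l u hu) hmix (i * 2 ^ k)).trans hcexp
  have hkmem : k ∈ dgcLevels T :=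
    Finset.mem_filter.2 ⟨Finset.mem_range.2 (by have := k.lt_two_pow_self; omega), hk⟩
  have hpotk := (Finset.single_le_sum (fun l _ => anhPot_nonneg _ _) hkmem).trans hpot
  have hmeta := le_sqrt_mul_of_anhPot_le (Finset.abs_sum_le_sum_abs _ _) hpotk
  rw [dgcStart_mul k hi] at hmeta
  have hC : ∑ u ∈ Finset.Icc ((i - 1) * 2 ^ k + 1) (i * 2 ^ k), |f u (w u) - f u (x k u)|
      ≤ (2 ^ k : ℕ) := by
    refine (Finset.sum_le_card_nsmul _ _ 1 fun u hu => hq k u ?_).trans_eq ?_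
    · have := (Finset.mem_Icc.1 hu).1
      omega
    · rw [nsmul_eq_mul, mul_one, Nat.card_Icc]
      congr 1
      omega
  have hmeta' : ∑ u ∈ Finset.Icc ((i - 1) * 2 ^ k + 1) (i * 2 ^ k), (f u (w u) - f u (x k u))
      ≤ Real.sqrt (3 * cAOD T (i * 2 ^ k)) * Real.sqrt (2 ^ k : ℕ) := by
    rw [← Real.sqrt_mul (by linarith)]
    refine hmeta.trans (Real.sqrt_le_sqrt ?_)
    gcongr
  have hogd : ∑ u ∈ Finset.Icc ((i - 1) * 2 ^ k + 1) (i * 2 ^ k), (f u (x k u) - f u v)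
      ≤ D * G * Real.sqrt (2 ^ k : ℕ) := by
    have hrw : ∑ u ∈ Finset.Icc ((i - 1) * 2 ^ k + 1) (i * 2 ^ k), (f u (x k u) - f u v)
        = ∑ s ∈ Finset.range (2 ^ k), (f ((i - 1) * 2 ^ k + 1 + s)
          (x k ((i - 1) * 2 ^ k + 1 + s)) - f ((i - 1) * 2 ^ k + 1 + s) v) := by
      rw [← Finset.Ico_add_one_right_eq_Icc, Finset.sum_Ico_eq_sum_range]
      rw [show i * 2 ^ k + 1 - ((i - 1) * 2 ^ k + 1) = 2 ^ k by omega]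
    rw [hrw]
    refine (Finset.sum_le_sum fun s _ => (hfconv _).sub_le_inner_gradient (hfdiff _ _) v).trans ?_
    refine sum_inner_le_of_projected_gradient hconv hdiam hproj (2 ^ k)
      (fun s => x k ((i - 1) * 2 ^ k + 1 + s)) _ (fun s => hxΩ k _ (by omega))
      (fun s => hgrad _ _ (hxΩ k _ (by omega))) (fun s => ?_) hv
    have := hxup k ((i - 1) * 2 ^ k + 1 + s) (by omega)
    rw [Nat.cast_pow, Nat.cast_ofNat]
    exact this
  rw [hlen, ← Finset.sum_sub_distrib, add_mul]
  refine le_trans (le_of_eq ?_) (add_le_add hmeta' hogd)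
  rw [← Finset.sum_add_distrib]
  simp
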